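/- Assume λ > 0. Let X be a mincut with r ∉ X, and suppose (C₀,…,C_ℓ) and (C′₀,…,C′_{ℓ′}) are both chains whose union equals X. Then ℓ = ℓ′, and either C_i = C′_i for all 0 ≤ i ≤ ℓ, or C_i = C′_{ℓ−i} for all 0 ≤ i ≤ ℓ. That is, the chain certificate of a mincut is unique up to reversal. -/

import Mathlib

open Finset

variable {V : Type*} [Fintype V] [DecidableEq V]

/-- `cutW w X Y` is `C(X,Y) = Σ_{x∈X} Σ_{y∈Y} w(x,y)`. -/
def cutW (w : V → V → ℝ) (X Y : Finset V) : ℝ := ∑ x ∈ X, ∑ y ∈ Y, w x y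

/-- `C(X) := C(X, V ∖ X)`. -/
def cutVal (w : V → V → ℝ) (X : Finset V) : ℝ := cutW w X Xᶜ

/-- A cut is a nonempty proper subset of `V`. -/
def IsCut (X : Finset V) : Prop := X.Nonempty ∧ X ≠ Finset.univ

/-- A mincut is a cut of minimum weight. -/
def IsMincut (w : V → V → ℝ) (X : Finset V) : Prop :=
  IsCut X ∧ ∀ Y : Finset V, IsCut Y → cutVal w X ≤ cutVal w Y

/-- `X` and `Y` cross if `X∩Y`, `X∖Y`, `Y∖X` and `V∖(X∪Y)` are all nonempty. -/
def Crosses (X Y : Finset V) : Prop :=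
  (X ∩ Y).Nonempty ∧ (X \ Y).Nonempty ∧ (Y \ X).Nonempty ∧ ((X ∪ Y)ᶜ).Nonempty

/-- A minimal mincut of a vertex `v`: a mincut containing `v` but not the root `r`,
of minimum cardinality among all such mincuts. -/
def IsMinimalMincutOfVertex (w : V → V → ℝ) (r v : V) (X : Finset V) : Prop :=
  IsMincut w X ∧ v ∈ X ∧ r ∉ X ∧
    ∀ Y : Finset V, IsMincut w Y → v ∈ Y → r ∉ Y → X.card ≤ Y.card

/-- An edge is an unordered pair of distinct vertices with positive weight. -/
def IsEdge (w : V → V → ℝ) (u₁ u₂ : V) : Prop := u₁ ≠ u₂ ∧ 0 < w u₁ u₂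

/-- A minimal mincut of an edge `{u₁,u₂}`: a mincut containing both endpoints but not the
root `r`, of minimum cardinality among all such mincuts. -/
def IsMinimalMincutOfEdge (w : V → V → ℝ) (r u₁ u₂ : V) (X : Finset V) : Prop :=
  IsEdge w u₁ u₂ ∧ IsMincut w X ∧ u₁ ∈ X ∧ u₂ ∈ X ∧ r ∉ X ∧
    ∀ Y : Finset V, IsMincut w Y → u₁ ∈ Y → u₂ ∈ Y → r ∉ Y → X.card ≤ Y.card

/-- Union of the members of a chain. -/
def chainUnion (C : List (Finset V)) : Finset V := C.foldr (· ∪ ·) ∅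

/-- `X ⊆ V∖{r}` has a certificate if it is the minimal mincut of some vertex,
the minimal mincut of some edge, or the union of a chain, where a chain is a sequence
`(C₀,…,C_ℓ)` (`ℓ ≥ 1`) of pairwise disjoint nonempty subsets of `V∖{r}` such that every
`C_i` has a certificate and each `C_i ∪ C_{i+1}` is the minimal mincut of some edge. -/
inductive HasCert (w : V → V → ℝ) (r : V) : Finset V → Prop
  | vertex {v : V} {X : Finset V} : IsMinimalMincutOfVertex w r v X → HasCert w r X
  | edge {u₁ u₂ : V} {X : Finset V} : IsMinimalMincutOfEdge w r u₁ u₂ X → HasCert w r X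
  | chain {C : List (Finset V)} :
      2 ≤ C.length →
      (∀ A ∈ C, A.Nonempty) →
      (∀ A ∈ C, r ∉ A) →
      C.Pairwise (fun A B => Disjoint A B) →
      (∀ A ∈ C, HasCert w r A) →
      (∀ i (h : i + 1 < C.length),
        ∃ u₁ u₂, IsMinimalMincutOfEdge w r u₁ u₂
          (C.get ⟨i, Nat.lt_of_succ_lt h⟩ ∪ C.get ⟨i + 1, h⟩)) →
      HasCert w r (chainUnion C)

/-- `(C₀,…,C_ℓ)` with `ℓ ≥ 1` is a chain. -/
def IsMincutChain (w : V → V → ℝ) (r : V) (C : List (Finset V)) : Prop :=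
  2 ≤ C.length ∧
  (∀ A ∈ C, A.Nonempty) ∧
  (∀ A ∈ C, r ∉ A) ∧
  C.Pairwise (fun A B => Disjoint A B) ∧
  (∀ A ∈ C, HasCert w r A) ∧
  (∀ i (h : i + 1 < C.length),
    ∃ u₁ u₂, IsMinimalMincutOfEdge w r u₁ u₂
      (C.get ⟨i, Nat.lt_of_succ_lt h⟩ ∪ C.get ⟨i + 1, h⟩))

/-- A subchain is a consecutive subsequence of a chain or of its reversal. -/
def IsSubchain (D C : List (Finset V)) : Prop := D <:+: C ∨ D <:+: C.reverse

/-- A maximal chain is a chain that is not a subchain of any strictly longer chain. -/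
def IsMaximalMincutChain (w : V → V → ℝ) (r : V) (C : List (Finset V)) : Prop :=
  IsMincutChain w r C ∧
    ¬ ∃ D : List (Finset V), IsMincutChain w r D ∧ C.length < D.length ∧ IsSubchain C D

/-- `lam` is the minimum weight of a cut. -/
def IsMincutValue (w : V → V → ℝ) (lam : ℝ) : Prop :=
  (∃ X : Finset V, IsCut X ∧ cutVal w X = lam) ∧
  ∀ X : Finset V, IsCut X → lam ≤ cutVal w X

section Helpers

lemma cutW_ind (w : V → V → ℝ) (X Y : Finset V) :
    cutW w X Y = ∑ x, ∑ y, if x ∈ X ∧ y ∈ Y then w x y else 0 := by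
  unfold cutW
  rw [← Finset.sum_subset (Finset.subset_univ X)]
  · apply Finset.sum_congr rfl
    intro x hx
    rw [← Finset.sum_subset (Finset.subset_univ Y)]
    · apply Finset.sum_congr rfl
      intro y hy
      simp [hx, hy]
    · intro y _ hy
      simp [hy]
  · intro x _ hx
    simp [hx]

lemma cutVal_submod (w : V → V → ℝ) (hn : ∀ x y, 0 ≤ w x y) (X Y : Finset V) :
    cutVal w (X ∩ Y) + cutVal w (X ∪ Y) ≤ cutVal w X + cutVal w Y := by
  unfold cutVal
  simp only [cutW_ind, ← Finset.sum_add_distrib]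
  apply Finset.sum_le_sum
  intro x _
  apply Finset.sum_le_sum
  intro y _
  have := hn x y
  by_cases h1 : x ∈ X <;> by_cases h2 : x ∈ Y <;> by_cases h3 : y ∈ X <;> by_cases h4 : y ∈ Y <;>
    simp [h1, h2, h3, h4, this]

lemma cutW_symm (w : V → V → ℝ) (hs : ∀ x y, w x y = w y x) (X Y : Finset V) :
    cutW w X Y = cutW w Y X := by
  unfold cutW
  rw [Finset.sum_comm]
  simp only [hs]

lemma cutVal_disj (w : V → V → ℝ) (hs : ∀ x y, w x y = w y x) (A B : Finset V)
    (hd : Disjoint A B) :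
    cutVal w A + cutVal w B = cutVal w (A ∪ B) + 2 * cutW w A B := by
  have h : cutVal w A + cutVal w B = cutVal w (A ∪ B) + (cutW w A B + cutW w B A) := by
    unfold cutVal
    simp only [cutW_ind, ← Finset.sum_add_distrib]
    apply Finset.sum_congr rfl
    intro x _
    apply Finset.sum_congr rfl
    intro y _
    have hx : x ∈ A → x ∉ B := fun h => Finset.disjoint_left.1 hd h
    have hy : y ∈ A → y ∉ B := fun h => Finset.disjoint_left.1 hd h
    by_cases h1 : x ∈ A <;> by_cases h2 : x ∈ B <;> by_cases h3 : y ∈ A <;>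
      by_cases h4 : y ∈ B <;> simp_all
  rw [h, cutW_symm w hs B A]
  ring

lemma cutW_two (w : V → V → ℝ) (hn : ∀ x y, 0 ≤ w x y) (P Q P' Q' Y Z : Finset V)
    (h1 : P ⊆ Y) (h2 : P' ⊆ Y) (h3 : Q ⊆ Z) (h4 : Q' ⊆ Z)
    (hd : Disjoint P P' ∨ Disjoint Q Q') :
    cutW w P Q + cutW w P' Q' ≤ cutW w Y Z := by
  simp only [cutW_ind, ← Finset.sum_add_distrib]
  apply Finset.sum_le_sum
  intro x _
  apply Finset.sum_le_sum
  intro y _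
  have := hn x y
  have a1 := @h1 x
  have a2 := @h2 x
  have a3 := @h3 y
  have a4 := @h4 y
  have hd' : ¬ ((x ∈ P ∧ y ∈ Q) ∧ (x ∈ P' ∧ y ∈ Q')) := by
    rintro ⟨⟨b1, b2⟩, b3, b4⟩
    rcases hd with hd | hd
    · exact Finset.disjoint_left.1 hd b1 b3
    · exact Finset.disjoint_left.1 hd b2 b4
  by_cases c1 : x ∈ P ∧ y ∈ Q
  · have c2 : ¬ (x ∈ P' ∧ y ∈ Q') := fun c => hd' ⟨c1, c⟩
    simp [c1, c2, a1 c1.1, a3 c1.2]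
  · by_cases c2 : x ∈ P' ∧ y ∈ Q'
    · simp [c1, c2, a2 c2.1, a4 c2.2]
    · simp only [c1, c2, if_false, add_zero]
      split_ifs <;> simp [this]

/-- The standing hypotheses, packed. -/
structure Ctx (w : V → V → ℝ) (lam : ℝ) : Prop where
  hs : ∀ x y, w x y = w y x
  hn : ∀ x y, 0 ≤ w x y
  hl : IsMincutValue w lam
  hp : 0 < lam

variable {w : V → V → ℝ} {lam : ℝ} {r : V}

lemma Ctx.val (c : Ctx w lam) {X : Finset V} (h : IsMincut w X) : cutVal w X = lam := by
  obtain ⟨⟨Z, hZ, hZl⟩, hm⟩ := c.hl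
  apply le_antisymm
  · rw [← hZl]; exact h.2 Z hZ
  · exact hm X h.1

/-- A mincut avoiding the root. -/
def RM (w : V → V → ℝ) (r : V) (X : Finset V) : Prop := IsMincut w X ∧ r ∉ X

lemma RM.ne {X : Finset V} (h : RM w r X) : X.Nonempty := h.1.1.1

lemma Ctx.cross (c : Ctx w lam) {X Y : Finset V} (hX : RM w r X) (hY : RM w r Y)
    (hi : (X ∩ Y).Nonempty) : RM w r (X ∩ Y) ∧ RM w r (X ∪ Y) := by
  have r1 : r ∉ X ∩ Y := fun h => hX.2 (Finset.mem_inter.1 h).1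
  have r2 : r ∉ X ∪ Y := fun h => (Finset.mem_union.1 h).elim hX.2 hY.2
  have c1 : IsCut (X ∩ Y) := ⟨hi, fun h => r1 (h ▸ Finset.mem_univ r)⟩
  have c2 : IsCut (X ∪ Y) := ⟨hi.mono (fun x hx => Finset.mem_union_left _ (Finset.mem_inter.1 hx).1),
    fun h => r2 (h ▸ Finset.mem_univ r)⟩
  have hsub := cutVal_submod w c.hn X Y
  rw [c.val hX.1, c.val hY.1] at hsub
  have l1 := c.hl.2 _ c1
  have l2 := c.hl.2 _ c2
  refine ⟨⟨⟨c1, fun Z hZ => ?_⟩, r1⟩, ⟨⟨c2, fun Z hZ => ?_⟩, r2⟩⟩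
  · have := c.hl.2 Z hZ; linarith
  · have := c.hl.2 Z hZ; linarith

lemma Ctx.half (c : Ctx w lam) {A B : Finset V} (hA : RM w r A) (hB : RM w r B)
    (hd : Disjoint A B) (hAB : RM w r (A ∪ B)) : 2 * cutW w A B = lam := by
  have := cutVal_disj w c.hs A B hd
  rw [c.val hA.1, c.val hB.1, c.val hAB.1] at this
  linarith

/-- Union is a minimal mincut of an edge. -/
def ERel (w : V → V → ℝ) (r : V) (A B : Finset V) : Prop :=
  ∃ u₁ u₂, IsMinimalMincutOfEdge w r u₁ u₂ (A ∪ B)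

lemma ERel.symm {A B : Finset V} (h : ERel w r A B) : ERel w r B A := by
  unfold ERel at *
  rwa [Finset.union_comm]

lemma ERel.rm {A B : Finset V} (h : ERel w r A B) : RM w r (A ∪ B) := by
  obtain ⟨u, v, h⟩ := h
  exact ⟨h.2.1, h.2.2.2.2.1⟩

/-- Working version of chains (length one allowed). -/
def Good (w : V → V → ℝ) (r : V) (C : List (Finset V)) : Prop :=
  (∀ A ∈ C, RM w r A) ∧ C.Pairwise (fun A B => Disjoint A B) ∧ C.IsChain (ERel w r)

lemma Good.tail {A : Finset V} {T : List (Finset V)} (h : Good w r (A :: T)) : Good w r T :=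
  ⟨fun B hB => h.1 B (List.mem_cons_of_mem _ hB), (List.pairwise_cons.1 h.2.1).2, h.2.2.tail⟩

lemma Good.reverse {C : List (Finset V)} (h : Good w r C) : Good w r C.reverse := by
  refine ⟨fun A hA => h.1 A (List.mem_reverse.1 hA), ?_, ?_⟩
  · rw [List.pairwise_reverse]
    exact h.2.1.imp (fun h => h.symm)
  · rw [List.isChain_reverse]
    exact h.2.2.imp (fun _ _ h => h.symm)

lemma mem_chainUnion {C : List (Finset V)} {x : V} : x ∈ chainUnion C ↔ ∃ A ∈ C, x ∈ A := by
  induction C with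
  | nil => simp [chainUnion]
  | cons A T ih =>
    have : chainUnion (A :: T) = A ∪ chainUnion T := rfl
    rw [this, Finset.mem_union, ih]
    simp

lemma chainUnion_cons (A : Finset V) (T : List (Finset V)) :
    chainUnion (A :: T) = A ∪ chainUnion T := rfl

lemma chainUnion_reverse (C : List (Finset V)) : chainUnion C.reverse = chainUnion C := by
  ext x
  simp [mem_chainUnion]

lemma subset_chainUnion {C : List (Finset V)} {A : Finset V} (h : A ∈ C) : A ⊆ chainUnion C :=
  fun _ hx => mem_chainUnion.2 ⟨A, h, hx⟩

lemma Good.disj {A : Finset V} {T : List (Finset V)} (h : Good w r (A :: T)) :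
    Disjoint A (chainUnion T) := by
  rw [Finset.disjoint_left]
  intro x hx hx'
  obtain ⟨B, hB, hxB⟩ := mem_chainUnion.1 hx'
  exact Finset.disjoint_left.1 ((List.pairwise_cons.1 h.2.1).1 B hB) hx hxB

lemma Good.union (c : Ctx w lam) {A : Finset V} {T : List (Finset V)} (h : Good w r (A :: T)) :
    RM w r (chainUnion (A :: T)) := by
  induction T generalizing A with
  | nil =>
    have : chainUnion [A] = A := by simp [chainUnion]
    rw [this]
    exact h.1 A (by simp)
  | cons B T ih =>
    have h1 := ih h.tail
    have h2 : RM w r (A ∪ B) := (List.isChain_cons_cons.1 h.2.2).1.rm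
    obtain ⟨x, hx⟩ := (h.1 B (by simp)).ne
    have h3 := (c.cross h2 h1 ⟨x, by simp [chainUnion_cons, hx]⟩).2
    have : A ∪ B ∪ chainUnion (B :: T) = chainUnion (A :: B :: T) := by
      ext y; simp [chainUnion_cons]
    rwa [this] at h3

lemma Good.nbr {C : List (Finset V)} (h : Good w r C) (hl : 2 ≤ C.length) {A : Finset V}
    (hA : A ∈ C) : ∃ B ∈ C, ERel w r A B ∧ Disjoint A B := by
  induction C with
  | nil => simp at hl
  | cons D T ih =>
    cases T with
    | nil => simp at hl
    | cons E T =>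
      have hDE := (List.isChain_cons_cons.1 h.2.2).1
      have hd : Disjoint D E := (List.pairwise_cons.1 h.2.1).1 E (by simp)
      rcases List.mem_cons.1 hA with rfl | hA
      · exact ⟨E, by simp, hDE, hd⟩
      · rcases List.mem_cons.1 hA with rfl | hA'
        · exact ⟨D, by simp, hDE.symm, hd.symm⟩
        · have hT : 2 ≤ (E :: T).length := by
            have := List.length_pos_of_mem hA'
            simp; omega
          obtain ⟨B, hB, h2⟩ := ih h.tail hT hA
          exact ⟨B, List.mem_cons_of_mem _ hB, h2⟩

/-- A bipartition into two mincuts. -/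
structure Bip (w : V → V → ℝ) (r : V) (X Y Z : Finset V) : Prop where
  hY : RM w r Y
  hZ : RM w r Z
  hd : Disjoint Y Z
  hU : Y ∪ Z = X

lemma Bip.symm {X Y Z : Finset V} (b : Bip w r X Y Z) : Bip w r X Z Y :=
  ⟨b.hZ, b.hY, b.hd.symm, by rw [Finset.union_comm, b.hU]⟩

lemma edge_sub (c : Ctx w lam) {u v : V} {D Y : Finset V} (h : IsMinimalMincutOfEdge w r u v D)
    (hY : RM w r Y) (hu : u ∈ Y) (hv : v ∈ Y) : D ⊆ Y := by
  obtain ⟨he, hm, hu', hv', hr, hmin⟩ := h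
  have h1 := (c.cross (X := D) (Y := Y) ⟨hm, hr⟩ hY ⟨u, by simp [hu, hu']⟩).1
  have h2 := hmin _ h1.1 (by simp [hu, hu']) (by simp [hv, hv']) h1.2
  have h3 := Finset.eq_of_subset_of_card_le (Finset.inter_subset_left (s₁ := D) (s₂ := Y)) h2
  exact Finset.inter_eq_left.1 h3

lemma no_split (c : Ctx w lam) {C : List (Finset V)} (h : Good w r C) (hl : 2 ≤ C.length)
    {Y Z : Finset V} (b : Bip w r (chainUnion C) Y Z) (hX : RM w r (chainUnion C))
    {A : Finset V} (hA : A ∈ C) : A ⊆ Y ∨ A ⊆ Z := by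
  by_contra hcon
  push Not at hcon
  obtain ⟨n1, n2⟩ := hcon
  have hAX : A ⊆ Y ∪ Z := by rw [b.hU]; exact subset_chainUnion hA
  have e1 : (A ∩ Z).Nonempty := by
    obtain ⟨x, hx, hx'⟩ := Finset.not_subset.1 n1
    exact ⟨x, by have := hAX hx; simp_all⟩
  have e2 : (A ∩ Y).Nonempty := by
    obtain ⟨x, hx, hx'⟩ := Finset.not_subset.1 n2
    exact ⟨x, by have := hAX hx; simp_all⟩
  have hAm := h.1 A hA
  have m1 := (c.cross hAm b.hZ e1).1
  have m2 := (c.cross hAm b.hY e2).1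
  have hAeq : A ∩ Y ∪ A ∩ Z = A := by
    rw [← Finset.inter_union_distrib_left, Finset.inter_eq_left]; exact hAX
  have k1 := c.half m2 m1 (b.hd.mono Finset.inter_subset_right Finset.inter_subset_right)
    (by rw [hAeq]; exact hAm)
  have k2 := c.half b.hY b.hZ b.hd (by rw [b.hU]; exact hX)
  have key : ∀ u v, u ∈ Y → v ∈ Z → 0 < w u v → u ∈ A ∧ v ∈ A := by
    intro u v hu hv huv
    by_contra hc
    have hh : Disjoint (A ∩ Y) {u} ∨ Disjoint (A ∩ Z) {v} := by
      simp only [Finset.disjoint_singleton_right, Finset.mem_inter]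
      tauto
    have := cutW_two w c.hn (A ∩ Y) (A ∩ Z) {u} {v} Y Z Finset.inter_subset_right (by simpa using hu)
      Finset.inter_subset_right (by simpa using hv) hh
    have e : cutW w {u} {v} = w u v := by simp [cutW]
    linarith
  obtain ⟨B, hB, ⟨u, v, huv⟩, hAB⟩ := h.nbr hl hA
  have hnA : ¬ (u ∈ A ∧ v ∈ A) := by
    rintro ⟨hu, hv⟩
    have := edge_sub c huv hAm hu hv
    obtain ⟨x, hx⟩ := (h.1 B hB).ne
    exact Finset.disjoint_left.1 hAB (this (by simp [hx])) hx
  have hDX : A ∪ B ⊆ Y ∪ Z := by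
    rw [b.hU]; exact Finset.union_subset (subset_chainUnion hA) (subset_chainUnion hB)
  have hu := Finset.mem_union.1 (hDX huv.2.2.1)
  have hv := Finset.mem_union.1 (hDX huv.2.2.2.1)
  have hw := huv.1.2
  rcases hu with hu | hu <;> rcases hv with hv | hv
  · exact n1 (Finset.subset_union_left.trans (edge_sub c huv b.hY hu hv))
  · exact hnA (key u v hu hv hw)
  · exact hnA (key v u hv hu (by rw [c.hs]; exact hw)).symm
  · exact n2 (Finset.subset_union_left.trans (edge_sub c huv b.hZ hu hv))

lemma step_next (c : Ctx w lam) {A B : Finset V} {T : List (Finset V)}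
    (h : Good w r (A :: B :: T)) {Y Z : Finset V} (b : Bip w r (chainUnion (A :: B :: T)) Y Z)
    (hA : A ⊆ Y) : B ⊆ Y ∨ Y = A := by
  have hX := h.union c
  rcases no_split c h (by simp) b hX (A := B) (by simp) with hB | hB
  · exact Or.inl hB
  right
  by_contra hne
  obtain ⟨x, hxY, hxA⟩ : ∃ x ∈ Y, x ∉ A := by
    by_contra hc
    push Not at hc
    exact hne (Finset.Subset.antisymm hc hA)
  have hW := h.tail.union c
  have hdW := h.disj
  set W := chainUnion (B :: T) with hWdef
  have hXW : Y ∪ Z = A ∪ W := b.hU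
  have hxW : x ∈ W := by
    have : x ∈ A ∪ W := by rw [← hXW]; simp [hxY]
    simpa [hxA] using this
  have m1 := (c.cross b.hY hW ⟨x, by simp [hxY, hxW]⟩).1
  have hZW : Z ⊆ W := by
    intro z hz
    have h1 : z ∈ A ∪ W := by rw [← hXW]; simp [hz]
    have h2 : z ∉ A := fun hzA => Finset.disjoint_left.1 b.hd (hA hzA) hz
    simpa [h2] using h1
  have hWeq : Y ∩ W ∪ Z = W := by
    ext z
    constructor
    · intro hz
      rcases Finset.mem_union.1 hz with hz | hz
      · exact (Finset.mem_inter.1 hz).2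
      · exact hZW hz
    · intro hz
      have : z ∈ Y ∪ Z := by rw [hXW]; simp [hz]
      rcases Finset.mem_union.1 this with h1 | h1 <;> simp [h1, hz]
  have k1 := c.half m1 b.hZ (b.hd.mono_left Finset.inter_subset_left) (by rw [hWeq]; exact hW)
  have k2 := c.half b.hY b.hZ b.hd (by rw [b.hU]; exact hX)
  have k3 := c.half (h.1 A (by simp)) (h.1 B (by simp))
    ((List.pairwise_cons.1 h.2.1).1 B (by simp)) (List.isChain_cons_cons.1 h.2.2).1.rm
  have k4 := cutW_two w c.hn A B (Y ∩ W) Z Y Z hA Finset.inter_subset_left hB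
    (Finset.Subset.refl _) (Or.inl (hdW.mono_right Finset.inter_subset_right))
  have := c.hp
  linarith

lemma last_sub (c : Ctx w lam) {A : Finset V} {T : List (Finset V)} (h : Good w r (A :: T))
    (hT : T ≠ []) {Y Z : Finset V} (b : Bip w r (chainUnion (A :: T)) Y Z) (hA : A ⊆ Z) :
    (A :: T).getLast (by simp) ⊆ Y := by
  induction T generalizing A Z with
  | nil => exact absurd rfl hT
  | cons B T ih =>
    rw [List.getLast_cons (by simp)]
    have hAB := step_next c h b.symm hA
    have hdW := h.disj
    have hYW : Y ⊆ chainUnion (B :: T) := by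
      intro y hy
      have h1 : y ∈ A ∪ chainUnion (B :: T) := by
        rw [← chainUnion_cons, ← b.hU]; simp [hy]
      have h2 : y ∉ A := fun hyA => Finset.disjoint_left.1 b.hd hy (hA hyA)
      simpa [h2] using h1
    have hUU : Y ∪ Z = A ∪ chainUnion (B :: T) := b.hU
    rcases hAB with hB | hZ
    · have hBW : B ⊆ chainUnion (B :: T) := subset_chainUnion (by simp)
      obtain ⟨x, hx⟩ := (h.1 B (by simp)).ne
      have m1 := (c.cross b.hZ (h.tail.union c) ⟨x, by simp [hB hx, hBW hx]⟩).1
      have b' : Bip w r (chainUnion (B :: T)) Y (Z ∩ chainUnion (B :: T)) := by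
        refine ⟨b.hY, m1, b.hd.mono_right Finset.inter_subset_left, ?_⟩
        ext z
        constructor
        · intro hz
          rcases Finset.mem_union.1 hz with hz | hz
          · exact hYW hz
          · exact (Finset.mem_inter.1 hz).2
        · intro hz
          have : z ∈ Y ∪ Z := by rw [hUU]; simp [hz]
          rcases Finset.mem_union.1 this with h1 | h1 <;> simp [h1, hz]
      by_cases hT' : T = []
      · subst hT'
        exfalso
        obtain ⟨y, hy⟩ := b.hY.ne
        have h1 := hYW hy
        simp [chainUnion] at h1
        exact Finset.disjoint_left.1 b.hd hy (hB h1)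
      · exact ih h.tail hT' b' (Finset.subset_inter hB hBW)
    · intro x hx
      have h1 : x ∈ chainUnion (B :: T) := subset_chainUnion (List.getLast_mem _) hx
      have h2 : x ∈ Y ∪ Z := by rw [hUU]; simp [h1]
      rcases Finset.mem_union.1 h2 with h2 | h2
      · exact h2
      · rw [hZ] at h2
        exact absurd h1 (Finset.disjoint_left.1 hdW h2)

lemma Good.bip (c : Ctx w lam) {A B : Finset V} {T : List (Finset V)}
    (h : Good w r (A :: B :: T)) :
    Bip w r (chainUnion (A :: B :: T)) A (chainUnion (B :: T)) :=
  ⟨h.1 A (by simp), h.tail.union c, h.disj, rfl⟩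

lemma Good.bip2 (c : Ctx w lam) {A B D : Finset V} {T : List (Finset V)}
    (h : Good w r (A :: B :: D :: T)) :
    Bip w r (chainUnion (A :: B :: D :: T)) (A ∪ B) (chainUnion (D :: T)) := by
  refine ⟨(List.isChain_cons_cons.1 h.2.2).1.rm, h.tail.tail.union c, ?_, ?_⟩
  · rw [Finset.disjoint_union_left]
    refine ⟨h.disj.mono_right ?_, h.tail.disj⟩
    rw [chainUnion_cons B]
    exact Finset.subset_union_right
  · simp [chainUnion_cons, Finset.union_assoc]

lemma second_sub (c : Ctx w lam) {A B B' : Finset V} {T T' : List (Finset V)}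
    (h : Good w r (A :: B :: T)) (h' : Good w r (A :: B' :: T'))
    (hU : chainUnion (A :: B :: T) = chainUnion (A :: B' :: T')) : B ⊆ B' := by
  have hAB : Disjoint A B := (List.pairwise_cons.1 h.2.1).1 B (by simp)
  have hAB' : Disjoint A B' := (List.pairwise_cons.1 h'.2.1).1 B' (by simp)
  have hsub : B ⊆ A ∪ B' := by
    cases T' with
    | nil =>
      have h1 : B ⊆ chainUnion (A :: B :: T) := subset_chainUnion (by simp)
      rw [hU] at h1
      simpa [chainUnion] using h1
    | cons D T' =>
      have b := h'.bip2 c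
      rw [← hU] at b
      rcases step_next c h b Finset.subset_union_left with h1 | h1
      · exact h1
      · exfalso
        obtain ⟨x, hx⟩ := (h'.1 B' (by simp)).ne
        have : x ∈ A := by rw [← h1]; simp [hx]
        exact Finset.disjoint_left.1 hAB' this hx
  intro x hx
  have h1 := hsub hx
  have h2 : x ∉ A := fun hA => Finset.disjoint_left.1 hAB hA hx
  simpa [h2] using h1

lemma same_head (c : Ctx w lam) {A : Finset V} {T T' : List (Finset V)}
    (h : Good w r (A :: T)) (h' : Good w r (A :: T'))
    (hU : chainUnion (A :: T) = chainUnion (A :: T')) : T = T' := by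
  have tails : chainUnion T = chainUnion T' := by
    have d1 := h.disj
    have d2 := h'.disj
    rw [chainUnion_cons, chainUnion_cons] at hU
    ext x
    have := Finset.ext_iff.1 hU x
    simp only [Finset.mem_union] at this
    have a1 : x ∈ A → x ∉ chainUnion T := fun hx => Finset.disjoint_left.1 d1 hx
    have a2 : x ∈ A → x ∉ chainUnion T' := fun hx => Finset.disjoint_left.1 d2 hx
    tauto
  induction T generalizing A T' with
  | nil =>
    cases T' with
    | nil => rfl
    | cons B' T' =>
      exfalso
      obtain ⟨x, hx⟩ := (h'.1 B' (by simp)).ne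
      have : x ∈ chainUnion (B' :: T') := subset_chainUnion (by simp) hx
      rw [← tails] at this
      simp [chainUnion] at this
  | cons B T ih =>
    cases T' with
    | nil =>
      exfalso
      obtain ⟨x, hx⟩ := (h.1 B (by simp)).ne
      have : x ∈ chainUnion (B :: T) := subset_chainUnion (by simp) hx
      rw [tails] at this
      simp [chainUnion] at this
    | cons B' T' =>
      have hB : B = B' :=
        Finset.Subset.antisymm (second_sub c h h' hU) (second_sub c h' h hU.symm)
      subst hB
      have t2 : chainUnion T = chainUnion T' := by
        have d1 := h.tail.disj
        have d2 := h'.tail.disj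
        rw [chainUnion_cons, chainUnion_cons] at tails
        ext x
        have := Finset.ext_iff.1 tails x
        simp only [Finset.mem_union] at this
        have a1 : x ∈ B → x ∉ chainUnion T := fun hx => Finset.disjoint_left.1 d1 hx
        have a2 : x ∈ B → x ∉ chainUnion T' := fun hx => Finset.disjoint_left.1 d2 hx
        tauto
      rw [ih h.tail h'.tail tails t2]

/-- If the head of `C'` contains the head of `C`, the two chains agree. -/
lemma head_sub (c : Ctx w lam) {A A' B B' : Finset V} {T T' : List (Finset V)}
    (h : Good w r (A :: B :: T)) (h' : Good w r (A' :: B' :: T'))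
    (hU : chainUnion (A :: B :: T) = chainUnion (A' :: B' :: T')) (hs : A ⊆ A') :
    A :: B :: T = A' :: B' :: T' := by
  have b := h.bip c
  rw [hU] at b
  have hA : A' = A := by
    rcases no_split c h' (by simp) b (h'.union c) (A := A') (by simp) with h1 | h1
    · exact Finset.Subset.antisymm h1 hs
    · exfalso
      obtain ⟨x, hx⟩ := b.hY.ne
      exact Finset.disjoint_left.1 b.hd hx (h1 (hs hx))
  subst hA
  rw [same_head c h h' hU]

lemma main_good (c : Ctx w lam) {C C' : List (Finset V)} (h : Good w r C) (h' : Good w r C')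
    (hl : 2 ≤ C.length) (hl' : 2 ≤ C'.length) (hU : chainUnion C = chainUnion C') :
    C = C' ∨ C = C'.reverse := by
  obtain ⟨A', B', T', rfl⟩ : ∃ A' B' T', C' = A' :: B' :: T' := by
    match C', hl' with
    | A' :: B' :: T', _ => exact ⟨A', B', T', rfl⟩
  have b := h'.bip c
  have key : ∀ D : List (Finset V), Good w r D → 2 ≤ D.length →
      chainUnion D = chainUnion (A' :: B' :: T') → (∀ A ∈ D.head?, A ⊆ A') →
      D = A' :: B' :: T' := by
    intro D hD hDl hDU hh
    match D, hDl with
    | A :: B :: T, _ => exact head_sub c hD h' hDU (hh A (by simp))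
  rw [← hU] at b
  match C, hl with
  | A :: B :: T, _ =>
    rcases no_split c h (by simp) b (h.union c) (A := A) (by simp) with h1 | h1
    · left
      exact key _ h (by simp) hU (by simpa using h1)
    · right
      have h2 := last_sub c h (by simp) b h1
      have := key (A :: B :: T).reverse h.reverse (by simp) (by rw [chainUnion_reverse, hU]) (by
        intro E hE
        rw [List.head?_reverse, List.getLast?_eq_getLast_of_ne_nil (by simp)] at hE
        simp only [Option.mem_def, Option.some.injEq] at hE
        rw [← hE]
        exact h2)
      rw [← this, List.reverse_reverse]

lemma good_of (C : List (Finset V)) (h1 : ∀ A ∈ C, RM w r A)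
    (h2 : C.Pairwise (fun A B => Disjoint A B))
    (h3 : ∀ i (h : i + 1 < C.length),
        ∃ u₁ u₂, IsMinimalMincutOfEdge w r u₁ u₂
          (C.get ⟨i, Nat.lt_of_succ_lt h⟩ ∪ C.get ⟨i + 1, h⟩)) : Good w r C := by
  refine ⟨h1, h2, ?_⟩
  rw [List.isChain_iff_getElem]
  intro i hi
  exact h3 i hi

lemma cert_rm (c : Ctx w lam) {X : Finset V} (h : HasCert w r X) : RM w r X := by
  induction h with
  | vertex h => exact ⟨h.1, h.2.2.1⟩
  | edge h => exact ⟨h.2.1, h.2.2.2.2.1⟩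
  | @chain C hl hne hr hd _ he ih =>
    have g := good_of C ih hd he
    match C, hl with
    | A :: T, _ => exact g.union c

end Helpers

/-- chain certificates of a mincut are unique up to reversal. -/
theorem chain_certificate_unique
    (r : V) (w : V → V → ℝ)
    (hcard : 1 < Fintype.card V)
    (hsym : ∀ x y, w x y = w y x)
    (hnonneg : ∀ x y, 0 ≤ w x y)
    (hdiag : ∀ x, w x x = 0)
    (lam : ℝ) (hlam : IsMincutValue w lam) (hpos : 0 < lam)
    (X : Finset V) (hX : IsMincut w X) (hrX : r ∉ X)
    (C C' : List (Finset V)) (hC : IsMincutChain w r C) (hC' : IsMincutChain w r C')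
    (hU : chainUnion C = X) (hU' : chainUnion C' = X) :
    C.length = C'.length ∧ (C = C' ∨ C = C'.reverse) := by
  have c : Ctx w lam := ⟨hsym, hnonneg, hlam, hpos⟩
  have g : Good w r C := good_of C (fun A hA => cert_rm c (hC.2.2.2.2.1 A hA)) hC.2.2.2.1 hC.2.2.2.2.2
  have g' : Good w r C' :=
    good_of C' (fun A hA => cert_rm c (hC'.2.2.2.2.1 A hA)) hC'.2.2.2.1 hC'.2.2.2.2.2
  have := main_good c g g' hC.1 hC'.1 (hU.trans hU'.symm)
  refine ⟨?_, this⟩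
  rcases this with h | h
  · rw [h]
  · rw [h, List.length_reverse]
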